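/- Let q be an odd prime, F = ℤ/qℤ, and ω a non-square unit of F. For every nonzero a ∈ F, exactly q(q-1)/2 matrices in the congruence orbit {GᵀAG : G ∈ GL₂(F)} of A = [[1,0],[0,-ω]] have (1,1)-entry equal to a, and no matrix in this orbit has (1,1)-entry equal to 0. -/

import Mathlib

open Matrix

section NormForm

variable {F : Type*} [Field F] {ω : F}

/-- The binary form `x² - ω y²` is anisotropic when `ω` is not a square. -/
theorem eq_zero_of_sq_sub_mul_sq_eq_zero (hω : ¬ IsSquare ω) {x y : F}
    (h : x ^ 2 - ω * y ^ 2 = 0) : x = 0 ∧ y = 0 := by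
  have hy : y = 0 := by
    by_contra hy
    refine hω ⟨x / y, ?_⟩
    field_simp
    linear_combination -h
  subst hy
  exact ⟨by simpa using h, rfl⟩

/-- Over a finite field of odd order, the form `x² - ω y²` represents every element. -/
theorem FiniteField.exists_sq_sub_mul_sq_eq [Fintype F] (hF : Fintype.card F % 2 = 1)
    (hω0 : ω ≠ 0) (a : F) : ∃ x y : F, x ^ 2 - ω * y ^ 2 = a := by
  open Polynomial in
  obtain ⟨x, y, h⟩ := FiniteField.exists_root_sum_quadratic (R := F)
    (f := X ^ 2 - C a) (g := C (-ω) * X ^ 2)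
    (degree_X_pow_sub_C (by decide) a) (degree_C_mul_X_pow 2 (neg_ne_zero.mpr hω0)) hF
  simp only [Polynomial.eval_sub, Polynomial.eval_pow, Polynomial.eval_X, Polynomial.eval_C,
    Polynomial.eval_mul] at h
  exact ⟨x, y, by linear_combination h⟩

/-- The Gram matrix of the columns of `!![x, z; y, w]` with respect to `x² - ω y²`. -/
theorem transpose_mul_diag_mul_fin_two (ω x y z w : F) :
    !![x, z; y, w]ᵀ * !![1, 0; 0, -ω] * !![x, z; y, w] =
      !![x ^ 2 - ω * y ^ 2, x * z - ω * (y * w);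
        x * z - ω * (y * w), z ^ 2 - ω * w ^ 2] := by
  ext i j
  fin_cases i <;> fin_cases j <;> simp [Matrix.mul_apply, Fin.sum_univ_two] <;> ring

/-- The congruent matrices with `(1,1)`-entry `a` are parametrized by the off-diagonal entry and
the nonzero square `r` for which the determinant is `-ω r`. -/
theorem setOf_congruent_diag_eq_image {a : F} (ha : a ≠ 0)
    (hrep : ∃ x y : F, x ^ 2 - ω * y ^ 2 = a) :
    {T : Matrix (Fin 2) (Fin 2) F |
      (∃ G : GL (Fin 2) F, T = (G : Matrix (Fin 2) (Fin 2) F)ᵀ * !![1, 0; 0, -ω] *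
        (G : Matrix (Fin 2) (Fin 2) F)) ∧ T 0 0 = a} =
    (fun p : F × Fˣ => !![a, p.1; p.1, (p.1 ^ 2 - ω * p.2) / a]) ''
      (Set.univ ×ˢ ((powMonoidHom 2 : Fˣ →* Fˣ).range : Set Fˣ)) := by
  ext T
  constructor
  · rintro ⟨⟨G, rfl⟩, h⟩
    have hdet : (G : Matrix (Fin 2) (Fin 2) F).det ≠ 0 := G.det.ne_zero
    generalize (G : Matrix (Fin 2) (Fin 2) F) = M at h hdet ⊢
    rw [Matrix.eta_fin_two M, transpose_mul_diag_mul_fin_two] at h ⊢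
    rw [Matrix.det_fin_two] at hdet
    generalize M 0 0 = x at *
    generalize M 0 1 = z at *
    generalize M 1 0 = y at *
    generalize M 1 1 = w at *
    replace h : x ^ 2 - ω * y ^ 2 = a := by simpa using h
    refine ⟨(x * z - ω * (y * w), Units.mk0 _ hdet ^ 2), ⟨trivial, Units.mk0 _ hdet, rfl⟩, ?_⟩
    have hd : ((x * z - ω * (y * w)) ^ 2 - ω * (x * w - z * y) ^ 2) / a =
        z ^ 2 - ω * w ^ 2 := by
      rw [div_eq_iff ha, ← h]
      ring
    simp [h, hd]
  · rintro ⟨⟨b, _⟩, ⟨-, s, rfl⟩, rfl⟩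
    obtain ⟨x, y, h⟩ := hrep
    have hdet : (!![x, (x * b + ω * y * s) / a; y, (y * b + x * s) / a]).det = (s : F) := by
      rw [Matrix.det_fin_two_of]
      field_simp
      linear_combination (s : F) * h
    refine ⟨⟨Matrix.GeneralLinearGroup.mkOfDetNeZero _ (hdet ▸ s.ne_zero), ?_⟩, by simp⟩
    have hb : x * ((x * b + ω * y * s) / a) - ω * (y * ((y * b + x * s) / a)) = b := by
      field_simp
      linear_combination b * h
    have hd : ((x * b + ω * y * s) / a) ^ 2 - ω * ((y * b + x * s) / a) ^ 2 =
        (b ^ 2 - ω * s ^ 2) / a := by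
      field_simp
      linear_combination (b ^ 2 - ω * s ^ 2) * h
    simp only [Matrix.GeneralLinearGroup.mkOfDetNeZero,
      Matrix.GeneralLinearGroup.val_mk', transpose_mul_diag_mul_fin_two, hb, hd, h]
    simp

/-- A finite field of odd order has `(|F| - 1) / 2` nonzero squares. -/
theorem FiniteField.ncard_range_sq_units [Fintype F] (hF : Fintype.card F % 2 = 1) :
    ((powMonoidHom 2 : Fˣ →* Fˣ).range : Set Fˣ).ncard = (Fintype.card F - 1) / 2 := by
  have h := IsCyclic.card_powMonoidHom_range (G := Fˣ) 2
  rw [Nat.card_units, Nat.card_eq_fintype_card (α := F),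
    Nat.gcd_eq_right (by omega : 2 ∣ Fintype.card F - 1)] at h
  exact h

end NormForm

/-- For `q` an odd prime, `ω` a non-square unit of `ℤ/qℤ`, and any `a ≠ 0`, exactly
`q(q-1)/2` matrices in the congruence orbit of `A = !![1,0;0,-ω]` have `(1,1)`-entry
`a`, and no matrix in the orbit has `(1,1)`-entry `0`. -/
theorem anisotropic_orbit_entry_card (q : ℕ) (hq : q.Prime) (hodd : Odd q)
    (ω : ZMod q) (hω0 : ω ≠ 0) (hω : ¬ IsSquare ω) :
    (∀ a : ZMod q, a ≠ 0 →
      Set.ncard {T : Matrix (Fin 2) (Fin 2) (ZMod q) |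
        (∃ G : GL (Fin 2) (ZMod q),
          T = (G : Matrix (Fin 2) (Fin 2) (ZMod q))ᵀ * !![1, 0; 0, -ω] *
            (G : Matrix (Fin 2) (Fin 2) (ZMod q))) ∧ T 0 0 = a} = q * (q - 1) / 2) ∧
    ∀ T : Matrix (Fin 2) (Fin 2) (ZMod q),
      (∃ G : GL (Fin 2) (ZMod q),
        T = (G : Matrix (Fin 2) (Fin 2) (ZMod q))ᵀ * !![1, 0; 0, -ω] *
          (G : Matrix (Fin 2) (Fin 2) (ZMod q))) → T 0 0 ≠ 0 := by
  have : Fact q.Prime := ⟨hq⟩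
  have hcard : Fintype.card (ZMod q) % 2 = 1 := by rw [ZMod.card, Nat.odd_iff.mp hodd]
  refine ⟨fun a ha => ?_, ?_⟩
  · rw [setOf_congruent_diag_eq_image ha (FiniteField.exists_sq_sub_mul_sq_eq hcard hω0 a),
      Set.ncard_image_of_injective, Set.ncard_prod, FiniteField.ncard_range_sq_units hcard,
      Set.ncard_univ, Nat.card_zmod, ZMod.card, Nat.mul_div_assoc]
    · rw [ZMod.card] at hcard
      omega
    · rintro ⟨b, r⟩ ⟨b', r'⟩ h
      have hb : b = b' := by simpa using congr_fun₂ h 0 1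
      subst hb
      have hr : (b ^ 2 - ω * r) / a = (b ^ 2 - ω * r') / a := by simpa using congr_fun₂ h 1 1
      rw [div_left_inj' ha, sub_right_inj, mul_right_inj' hω0] at hr
      rw [Units.ext hr]
  · rintro _ ⟨G, rfl⟩ h
    have hdet : (G : Matrix (Fin 2) (Fin 2) (ZMod q)).det ≠ 0 := G.det.ne_zero
    rw [Matrix.eta_fin_two (G : Matrix (Fin 2) (Fin 2) (ZMod q)),
      transpose_mul_diag_mul_fin_two] at h
    obtain ⟨hx, hy⟩ := eq_zero_of_sq_sub_mul_sq_eq_zero hω h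
    rw [Matrix.det_fin_two, hx, hy] at hdet
    simp at hdet
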